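/- arXiv:1406.2108 — 2 statements merged into one kernel-verified Lean document; each statement's English description precedes it below -/
import Mathlib

section
/- Let r ≥ 2 and d_1, ..., d_r ≥ 1 be integers, set D_1 = d_1 + ... + d_r and D_2 = Σ_{1 ≤ i < j ≤ r} d_i·d_j. Let q' be a prime power and q an integer with q' > q > D_2 and q' ≥ D_1, let n ≥ D_1 be an integer, let S ⊆ F_{q'}^n be a hitting set for H_{D_2} over F_{q'}, and let F be a (q',q,(d_1,...,d_r))-separating hash family on the ground set F_{q'}. Then the family {a ↦ f(b_a) : f ∈ F, b = (b_1,...,b_n) ∈ S} of functions from [n] to the range of F is an (n,q,(d_1,...,d_r))-separating hash family; consequently M(n,q,(d_1,...,d_r)) ≤ M(q',q,(d_1,...,d_r))·|S|. -/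
/-- A family `G` of functions `X → [q]` is an `(|X|,q,(d₁,…,d_r))`-separating hash
family if for all pairwise disjoint subsets `C₁,…,C_r ⊆ X` with `|Cᵢ| = dᵢ`, some
`f ∈ G` maps them to pairwise disjoint images. -/
def IsSHF {X : Type*} [DecidableEq X] {r q : ℕ} (d : Fin r → ℕ)
    (G : Finset (X → Fin q)) : Prop :=
  ∀ C : Fin r → Finset X, (∀ i, (C i).card = d i) →
    (Pairwise fun i j => Disjoint (C i) (C j)) →
    ∃ f ∈ G, Pairwise fun i j => Disjoint ((C i).image f) ((C j).image f)

/-- `M(m,q,(d₁,…,d_r))`: the minimum size of an `(m,q,(d₁,…,d_r))`-separating hash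
family. -/
noncomputable def SHFmin (m q r : ℕ) (d : Fin r → ℕ) : ℕ :=
  sInf {s : ℕ | ∃ G : Finset (Fin m → Fin q), G.card = s ∧ IsSHF d G}

/-- Pairwise disjoint finsets can be enlarged to pairwise disjoint finsets of prescribed
cardinalities, provided the ambient type is large enough. -/
theorem exists_pairwise_disjoint_superset_card_eq {ι X : Type*} [Fintype ι] [DecidableEq ι]
    [Fintype X] [DecidableEq X] (d : ι → ℕ) (A : ι → Finset X)
    (hA : ∀ i, (A i).card ≤ d i) (hdis : Pairwise fun i j => Disjoint (A i) (A j))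
    (hX : ∑ i, d i ≤ Fintype.card X) :
    ∃ B : ι → Finset X, (∀ i, A i ⊆ B i) ∧ (∀ i, (B i).card = d i) ∧
      Pairwise fun i j => Disjoint (B i) (B j) := by
  suffices H : ∀ t : Finset ι, ∃ B : ι → Finset X, (∀ i, A i ⊆ B i) ∧
      (∀ i, (B i).card ≤ d i) ∧ (∀ i ∈ t, (B i).card = d i) ∧
      Pairwise fun i j => Disjoint (B i) (B j) by
    obtain ⟨B, hAB, -, hB, hBd⟩ := H Finset.univ
    exact ⟨B, hAB, fun i => hB i (Finset.mem_univ i), hBd⟩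
  intro t
  induction t using Finset.induction_on with
  | empty => exact ⟨A, fun i => Finset.Subset.refl _, hA, by simp, hdis⟩
  | insert k t _ ih =>
    obtain ⟨B, hAB, hBle, hBt, hBd⟩ := ih
    set U := (Finset.univ.erase k).biUnion B with hU
    have hUcard : U.card ≤ ∑ i ∈ Finset.univ.erase k, d i :=
      Finset.card_biUnion_le.trans (Finset.sum_le_sum fun i _ => hBle i)
    have hsum : d k + ∑ i ∈ Finset.univ.erase k, d i = ∑ i, d i :=
      Finset.add_sum_erase _ d (Finset.mem_univ k)
    have hcompl : d k ≤ Uᶜ.card := by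
      rw [Finset.card_compl]
      omega
    have hsub : B k ⊆ Uᶜ := by
      refine Finset.subset_compl_iff_disjoint_right.2 ?_
      rw [hU, Finset.disjoint_biUnion_right]
      exact fun i hi => hBd (Finset.ne_of_mem_erase hi).symm
    obtain ⟨E, hBE, hEU, hE⟩ := Finset.exists_subsuperset_card_eq hsub (hBle k) hcompl
    have hEdis : ∀ i, i ≠ k → Disjoint E (B i) := by
      intro i hi
      have hiU : B i ⊆ U :=
        Finset.subset_biUnion_of_mem B (Finset.mem_erase.2 ⟨hi, Finset.mem_univ i⟩)
      exact (disjoint_compl_left.mono_left hEU).mono_right hiU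
    refine ⟨Function.update B k E, fun i => ?_, fun i => ?_, fun i hi => ?_, fun i j hij => ?_⟩
    · rcases eq_or_ne i k with rfl | hik
      · simpa using (hAB i).trans hBE
      · simpa [hik] using hAB i
    · rcases eq_or_ne i k with rfl | hik
      · simp [hE]
      · simpa [hik] using hBle i
    · rcases eq_or_ne i k with rfl | hik
      · simp [hE]
      · simpa [hik] using hBt i (Finset.mem_of_mem_insert_of_ne hi hik)
    · rcases eq_or_ne i k with rfl | hik
      · simpa [hij.symm] using hEdis j hij.symm
      · rcases eq_or_ne j k with rfl | hjk
        · simpa [hij] using (hEdis i hij).symm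
        · simpa [hik, hjk] using hBd hij

/-- Separating hash families transport along a bijection of ground sets. -/
theorem IsSHF.image_comp_equiv {X Y : Type*} [DecidableEq X] [DecidableEq Y]
    [Fintype Y] {r q : ℕ} {d : Fin r → ℕ} {G : Finset (X → Fin q)}
    (hG : IsSHF d G) (e : Y ≃ X) : IsSHF d (G.image fun f => f ∘ e) := by
  intro C hC hdis
  obtain ⟨f, hf, hsep⟩ := hG (fun i => (C i).image e)
    (fun i => by rw [Finset.card_image_of_injective _ e.injective, hC i])
    (fun i j hij => (Finset.disjoint_image e.injective).2 (hdis hij))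
  refine ⟨f ∘ e, Finset.mem_image_of_mem _ hf, fun i j hij => ?_⟩
  simpa only [Finset.image_image] using hsep hij

/-- Composing a separating hash family with a hitting set of vectors gives a separating
hash family on the coordinates. -/
theorem IsSHF.image_comp_hittingSet {X Y : Type*} [DecidableEq X] [DecidableEq Y]
    [Fintype X] [Fintype Y] {r q : ℕ} {d : Fin r → ℕ} (hX : ∑ i, d i ≤ Fintype.card X)
    {S : Finset (Y → X)}
    (hS : ∀ I : Finset (Y × Y),
      I.card ≤ (∑ i, ∑ j, if i < j then d i * d j else 0) → (∀ p ∈ I, p.1 ≠ p.2) →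
      ∃ a ∈ S, ∀ p ∈ I, a p.1 ≠ a p.2)
    {G : Finset (X → Fin q)} (hG : IsSHF d G) :
    IsSHF d ((G ×ˢ S).image (fun p => fun a : Y => p.1 (p.2 a))) := by
  intro C hC hdis
  let I : Finset (Y × Y) := Finset.univ.biUnion fun i => Finset.univ.biUnion fun j =>
    if i < j then C i ×ˢ C j else ∅
  have hmem : ∀ p : Y × Y, p ∈ I ↔ ∃ i j, i < j ∧ p.1 ∈ C i ∧ p.2 ∈ C j := by
    intro p
    simp only [I, Finset.mem_biUnion, Finset.mem_univ, true_and]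
    refine exists_congr fun i => exists_congr fun j => ?_
    split_ifs with h <;> simp [h]
  obtain ⟨b, hbS, hb⟩ := hS I
    (by
      refine Finset.card_biUnion_le.trans (Finset.sum_le_sum fun i _ =>
        Finset.card_biUnion_le.trans (Finset.sum_le_sum fun j _ => ?_))
      split_ifs <;> simp [hC])
    (by
      intro p hp
      obtain ⟨i, j, hij, h1, h2⟩ := (hmem p).1 hp
      exact Finset.disjoint_iff_ne.1 (hdis hij.ne) _ h1 _ h2)
  have hlt : ∀ i j, i < j → Disjoint ((C i).image b) ((C j).image b) := by
    intro i j hij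
    simp only [Finset.disjoint_iff_ne, Finset.forall_mem_image]
    exact fun x hx y hy => hb (x, y) ((hmem (x, y)).2 ⟨i, j, hij, hx, hy⟩)
  obtain ⟨B, hCB, hB, hBd⟩ := exists_pairwise_disjoint_superset_card_eq d
    (fun i => (C i).image b) (fun i => Finset.card_image_le.trans (hC i).le)
    (fun i j hij => (lt_or_gt_of_ne hij).elim (hlt i j) fun h => (hlt j i h).symm) hX
  obtain ⟨f, hf, hsep⟩ := hG B hB hBd
  refine ⟨fun a => f (b a), Finset.mem_image.2 ⟨(f, b), Finset.mem_product.2 ⟨hf, hbS⟩, rfl⟩,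
    fun i j hij => ?_⟩
  have himg : ∀ i, (C i).image (fun a => f (b a)) ⊆ (B i).image f := by
    intro i
    have h := Finset.image_subset_image (f := f) (hCB i)
    rwa [Finset.image_image] at h
  exact (hsep hij).mono (himg i) (himg j)

/-- Let `r ≥ 2`, `d₁,…,d_r ≥ 1`, `D₁ = Σ dᵢ`, `D₂ = Σ_{i<j} dᵢdⱼ`.  Let `q'` be a
prime power and `q` an integer with `q' > q > D₂` and `q' ≥ D₁`, let `n ≥ D₁`, let
`S ⊆ F_{q'}^n` be a hitting set for `H_{D₂}` over `F_{q'}`, and let `Fam` be a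
`(q',q,(d₁,…,d_r))`-separating hash family on the ground set `F_{q'}`.  Then the
family `{a ↦ f(b_a) : f ∈ Fam, b ∈ S}` is an `(n,q,(d₁,…,d_r))`-separating hash
family of size at most `|Fam|·|S|`; consequently
`M(n,q,(d₁,…,d_r)) ≤ M(q',q,(d₁,…,d_r))·|S|`. -/
theorem SHF_from_hitting_set (r : ℕ) (hr : 2 ≤ r) (d : Fin r → ℕ)
    (hd : ∀ i, 1 ≤ d i) (q' q n : ℕ) (hq' : IsPrimePow q') (hq'q : q' > q)
    (hqD2 : q > (∑ i, ∑ j, if i < j then d i * d j else 0))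
    (hq'D1 : q' ≥ ∑ i, d i) (hn : n ≥ ∑ i, d i)
    (F : Type) [Field F] [Fintype F] [DecidableEq F] (hF : Fintype.card F = q')
    (S : Finset (Fin n → F))
    (hS : ∀ I : Finset (Fin n × Fin n),
      I.card ≤ (∑ i, ∑ j, if i < j then d i * d j else 0) → (∀ p ∈ I, p.1 ≠ p.2) →
      ∃ a ∈ S, ∀ p ∈ I, a p.1 ≠ a p.2)
    (Fam : Finset (F → Fin q)) (hFam : IsSHF d Fam) :
    IsSHF d ((Fam ×ˢ S).image (fun p => fun a : Fin n => p.1 (p.2 a))) ∧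
    ((Fam ×ˢ S).image (fun p => fun a : Fin n => p.1 (p.2 a))).card ≤
      Fam.card * S.card ∧
    SHFmin n q r d ≤ SHFmin q' q r d * S.card := by
  have hcard : ∀ G : Finset (F → Fin q),
      ((G ×ˢ S).image (fun p => fun a : Fin n => p.1 (p.2 a))).card ≤ G.card * S.card :=
    fun G => Finset.card_image_le.trans (Finset.card_product G S).le
  have hX : ∑ i, d i ≤ Fintype.card F := by omega
  refine ⟨hFam.image_comp_hittingSet hX hS, hcard Fam, ?_⟩
  let e : F ≃ Fin q' := Fintype.equivFinOfCardEq hF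
  obtain ⟨G, hGcard, hG⟩ : SHFmin q' q r d ∈
      {s : ℕ | ∃ G : Finset (Fin q' → Fin q), G.card = s ∧ IsSHF d G} :=
    Nat.sInf_mem ⟨_, _, rfl, hFam.image_comp_equiv e.symm⟩
  have hle : SHFmin n q r d ≤ _ :=
    Nat.sInf_le ⟨_, rfl, (hG.image_comp_equiv e).image_comp_hittingSet hX hS⟩
  refine hle.trans ((hcard _).trans ?_)
  rw [← hGcard]
  exact Nat.mul_le_mul_right _ Finset.card_image_le
end

section
/- There exists an absolute constant C > 0 such that for all integers w, r ≥ 1 and n ≥ 2 with n ≥ w + r, setting d = w + r, there exists an (n,(w,r))-cover-free family of size at most C · √(w·r·d) · C(d,w) · log n, where C(d,w) denotes the binomial coefficient d choose w. -/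
open Finset in
/-- Greedy covering: if every requirement in `S` is met by at least a `p`-fraction of the points of
`X`, then some `m` points leave at most a `(1 - p) ^ m`-fraction of the requirements unmet. -/
lemma exists_greedy_cover {X T : Type*} [Fintype X] [Nonempty X] (S : Finset T)
    (good : T → X → Prop) [∀ t x, Decidable (good t x)] (p : ℝ) (hp1 : p ≤ 1)
    (hp : ∀ t ∈ S, p * Fintype.card X ≤ #{x | good t x}) (m : ℕ) :
    ∃ (F : Finset X) (U : Finset T), #F ≤ m ∧ (∀ t ∈ S, t ∉ U → ∃ x ∈ F, good t x) ∧
      U ⊆ S ∧ (#U : ℝ) ≤ (1 - p) ^ m * #S := by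
  classical
  induction m with
  | zero => exact ⟨∅, S, by simp, fun t ht ht' => absurd ht ht', Subset.rfl, by simp⟩
  | succ m ih =>
    obtain ⟨F, U, hFm, hcov, hUS, hU⟩ := ih
    have hdouble : ∑ x : X, (#{t ∈ U | good t x} : ℝ) = ∑ t ∈ U, (#{x | good t x} : ℝ) := by
      exact_mod_cast (sum_card_bipartiteAbove_eq_sum_card_bipartiteBelow
        (s := U) (t := (univ : Finset X)) good).symm
    have hsum : ∑ _x : X, p * (#U : ℝ) ≤ ∑ x : X, (#{t ∈ U | good t x} : ℝ) := by
      rw [hdouble]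
      calc ∑ _x : X, p * (#U : ℝ) = ∑ _t ∈ U, p * (Fintype.card X : ℝ) := by
            simp only [sum_const, card_univ, nsmul_eq_mul]
            ring
        _ ≤ _ := sum_le_sum fun t ht => hp t (hUS ht)
    obtain ⟨x, -, hx⟩ := exists_le_of_sum_le univ_nonempty hsum
    refine ⟨insert x F, {t ∈ U | ¬ good t x}, (card_insert_le _ _).trans (by omega),
      fun t ht htU => ?_, (filter_subset _ _).trans hUS, ?_⟩
    · by_cases hx' : good t x
      · exact ⟨x, mem_insert_self _ _, hx'⟩
      · obtain ⟨y, hy, hty⟩ := hcov t ht fun h => htU (mem_filter.2 ⟨h, hx'⟩)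
        exact ⟨y, mem_insert_of_mem hy, hty⟩
    have hsplit : (#{t ∈ U | good t x} : ℝ) + #{t ∈ U | ¬ good t x} = #U := by
      exact_mod_cast card_filter_add_card_filter_not (s := U) (fun t => good t x)
    calc (#{t ∈ U | ¬ good t x} : ℝ) ≤ (1 - p) * #U := by linarith
      _ ≤ (1 - p) * ((1 - p) ^ m * #S) :=
          mul_le_mul_of_nonneg_left hU (sub_nonneg.2 hp1)
      _ = (1 - p) ^ (m + 1) * #S := by ring

open Nat in
lemma factorial_le_exp_one_mul_stirling {n : ℕ} (hn : n ≠ 0) :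
    (n ! : ℝ) ≤ Real.exp 1 * √n * (n / Real.exp 1) ^ n := by
  obtain ⟨k, rfl⟩ := Nat.exists_eq_succ_of_ne_zero hn
  have h : Stirling.stirlingSeq (k + 1) ≤ Real.exp 1 / √2 :=
    (Stirling.stirlingSeq'_antitone (Nat.zero_le k)).trans_eq Stirling.stirlingSeq_one
  rw [Stirling.stirlingSeq, div_le_iff₀ (by positivity), Real.sqrt_mul (by norm_num)] at h
  refine h.trans_eq ?_
  field_simp

lemma sqrt_mul_pow_le_choose {w r : ℕ} (hw : w ≠ 0) (hr : r ≠ 0) :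
    √((w : ℝ) + r) * ((w : ℝ) + r) ^ (w + r) ≤
      4 * (w + r).choose w * (√w * √r) * ((w : ℝ) ^ w * (r : ℝ) ^ r) := by
  have hd := Stirling.le_factorial_stirling (w + r)
  have hW := factorial_le_exp_one_mul_stirling hw
  have hR := factorial_le_exp_one_mul_stirling hr
  have hC : ((w + r).factorial : ℝ) = (w + r).choose w * (w.factorial * r.factorial) := by
    rw [← mul_assoc]
    exact_mod_cast (Nat.choose_mul_factorial_mul_factorial (Nat.le_add_right w r)).symm.trans
      (by rw [Nat.add_sub_cancel_left])
  have h2 : (2 : ℝ) ≤ √(2 * Real.pi) := by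
    apply Real.le_sqrt_of_sq_le
    nlinarith [Real.pi_gt_three]
  have he : Real.exp 1 * Real.exp 1 ≤ 8 := by
    nlinarith [Real.exp_one_lt_d9, Real.exp_pos 1]
  have key : √(2 * Real.pi) * √((w : ℝ) + r) * (((w : ℝ) + r) / Real.exp 1) ^ (w + r) ≤
      (w + r).choose w * ((Real.exp 1 * √w * (w / Real.exp 1) ^ w) *
        (Real.exp 1 * √r * (r / Real.exp 1) ^ r)) := by
    rw [← Real.sqrt_mul (by positivity)]
    push_cast at hd
    refine hd.trans ?_
    rw [hC]
    gcongr
  simp only [div_pow, pow_add (Real.exp 1)] at key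
  have key' : √(2 * Real.pi) * (√((w : ℝ) + r) * ((w : ℝ) + r) ^ (w + r)) ≤
      (Real.exp 1 * Real.exp 1) *
        ((w + r).choose w * (√w * √r) * ((w : ℝ) ^ w * (r : ℝ) ^ r)) := by
    have hexpw : 0 < Real.exp 1 ^ w := by positivity
    have hexpr : 0 < Real.exp 1 ^ r := by positivity
    generalize Real.exp 1 ^ w = a at key hexpw
    generalize Real.exp 1 ^ r = b at key hexpr
    generalize Real.exp 1 = e at key ⊢
    generalize ((w : ℝ) + r) ^ (w + r) = z at key ⊢
    have := mul_le_mul_of_nonneg_right key (mul_pos hexpw hexpr).le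
    refine (Eq.trans_le ?_ this).trans_eq ?_
    · field_simp
    · field_simp
  have hl := mul_le_mul_of_nonneg_right h2
    (by positivity : 0 ≤ √((w : ℝ) + r) * ((w : ℝ) + r) ^ (w + r))
  have hu := mul_le_mul_of_nonneg_right he
    (by positivity : 0 ≤ ((w + r).choose w * (√w * √r) * ((w : ℝ) ^ w * (r : ℝ) ^ r)))
  linarith

open Finset in
/-- Among the colourings `[n] → [w + r]`, those sending `W` below `w` and `R` to at least `w`. -/
lemma card_separating_colourings {w r n : ℕ} (W R : Finset (Fin n)) (hW : #W = w)
    (hR : #R = r) (hWR : Disjoint W R) :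
    #{f : Fin n → Fin (w + r) | (∀ i ∈ W, (f i : ℕ) < w) ∧ ∀ i ∈ R, ¬ (f i : ℕ) < w} *
      (w + r) ^ (w + r) = w ^ w * r ^ r * (w + r) ^ n := by
  classical
  let A : Finset (Fin (w + r)) := {j | (j : ℕ) < w}
  let B : Finset (Fin (w + r)) := {j | ¬ (j : ℕ) < w}
  have hA : #A = w := by
    rw [Fin.card_filter_val_lt]
    exact min_eq_right (Nat.le_add_right w r)
  have hB : #B = r := by
    have := card_filter_add_card_filter_not (s := (univ : Finset (Fin (w + r))))
      (fun j => (j : ℕ) < w)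
    rw [card_univ, Fintype.card_fin] at this
    change #A + #B = w + r at this
    omega
  have hset : ({f | (∀ i ∈ W, (f i : ℕ) < w) ∧ ∀ i ∈ R, ¬ (f i : ℕ) < w} :
      Finset (Fin n → Fin (w + r))) =
      Fintype.piFinset fun i => if i ∈ W then A else if i ∈ R then B else univ := by
    ext f
    simp only [mem_filter, mem_univ, true_and, Fintype.mem_piFinset]
    constructor
    · rintro ⟨h1, h2⟩ i
      split_ifs with hi hi'
      · simpa [A] using h1 i hi
      · simpa [B] using h2 i hi'
      · exact mem_univ _
    · intro h
      refine ⟨fun i hi => ?_, fun i hi => ?_⟩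
      · simpa [hi, A] using h i
      · simpa [hi, disjoint_right.1 hWR hi, B] using h i
  have hcard : #(W ∪ R) = w + r := by rw [card_union_of_disjoint hWR, hW, hR]
  have hn : w + r ≤ n := by simpa [hcard] using card_le_univ (W ∪ R)
  rw [hset, Fintype.card_piFinset, ← prod_mul_prod_compl (W ∪ R), prod_union hWR]
  have h1 : ∏ i ∈ W, #(if i ∈ W then A else if i ∈ R then B else univ) = w ^ w := by
    rw [prod_congr rfl (g := fun _ => w) fun i hi => by simp [hi, hA], prod_const, hW]
  have h2 : ∏ i ∈ R, #(if i ∈ W then A else if i ∈ R then B else univ) = r ^ r := by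
    rw [prod_congr rfl (g := fun _ => r) fun i hi => by
      simp [hi, disjoint_right.1 hWR hi, hB], prod_const, hR]
  have h3 : ∏ i ∈ (W ∪ R)ᶜ, #(if i ∈ W then A else if i ∈ R then B else univ) =
      (w + r) ^ (n - (w + r)) := by
    rw [prod_congr rfl (g := fun _ => w + r) fun i hi => by
      simp only [mem_compl, mem_union, not_or] at hi
      simp [hi.1, hi.2], prod_const, card_compl, hcard, Fintype.card_fin]
  rw [h1, h2, h3, mul_assoc, ← pow_add, Nat.sub_add_cancel hn]

/-- There exists an absolute constant `C > 0` such that for all integers `w, r ≥ 1`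
and `n ≥ 2` with `n ≥ w + r`, setting `d = w + r`, there exists an
`(n,(w,r))`-cover-free family of size at most `C·√(w·r·d)·C(d,w)·log n` (base-2
logarithm): a set `F ⊆ {0,1}^n` such that for all disjoint `W, R ⊆ [n]` with
`|W| = w` and `|R| = r` there is `a ∈ F` which is `1` on `W` and `0` on `R`. -/
theorem exists_CFF_union_bound :
    ∃ C : ℝ, C > 0 ∧
      ∀ w r n : ℕ, 1 ≤ w → 1 ≤ r → 2 ≤ n → w + r ≤ n →
        ∃ Fam : Finset (Fin n → Bool),
          (∀ W R : Finset (Fin n), W.card = w → R.card = r → Disjoint W R →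
            ∃ a ∈ Fam, (∀ i ∈ W, a i = true) ∧ (∀ i ∈ R, a i = false)) ∧
          (Fam.card : ℝ) ≤
            C * Real.sqrt ((w : ℝ) * r * (w + r)) * ((w + r).choose w) *
              Real.logb 2 n := by
  classical
  refine ⟨8, by norm_num, fun w r n hw hr hn hd => ?_⟩
  have hw0 : (0 : ℝ) < w := by exact_mod_cast hw
  have hr0 : (0 : ℝ) < r := by exact_mod_cast hr
  set p : ℝ := (w : ℝ) ^ w * (r : ℝ) ^ r / ((w : ℝ) + r) ^ (w + r) with hp
  have hp0 : 0 < p := by positivity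
  have hp1 : p ≤ 1 := by
    rw [hp, div_le_one (by positivity), pow_add]
    gcongr <;> linarith
  have hlogn : 0 < Real.log n := Real.log_pos (by exact_mod_cast hn)
  have hd2 : (2 : ℝ) ≤ (w : ℝ) + r := by exact_mod_cast Nat.add_le_add hw hr
  let S : Finset (Finset (Fin n) × Finset (Fin n)) :=
    {t ∈ Finset.powersetCard w Finset.univ ×ˢ Finset.powersetCard r Finset.univ |
      Disjoint t.1 t.2}
  have hScard : (S.card : ℝ) ≤ (n : ℝ) ^ (w + r) := by
    have : S.card ≤ n ^ w * n ^ r := by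
      refine (Finset.card_filter_le _ _).trans ?_
      rw [Finset.card_product, Finset.card_powersetCard, Finset.card_powersetCard,
        Finset.card_univ, Fintype.card_fin]
      exact Nat.mul_le_mul (Nat.choose_le_pow _ _) (Nat.choose_le_pow _ _)
    rw [pow_add]
    exact_mod_cast this
  let good (t : Finset (Fin n) × Finset (Fin n)) (f : Fin n → Fin (w + r)) : Prop :=
    (∀ i ∈ t.1, (f i : ℕ) < w) ∧ ∀ i ∈ t.2, ¬ (f i : ℕ) < w
  have : NeZero (w + r) := ⟨by omega⟩
  set L : ℝ := ((w : ℝ) + r) * Real.log n with hL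
  set m : ℕ := ⌊L / p⌋₊ + 1 with hm
  obtain ⟨F, U, hFm, hcov, -, hFU⟩ := exists_greedy_cover S good p hp1 (fun t ht => by
    simp only [S, Finset.mem_filter, Finset.mem_product, Finset.mem_powersetCard] at ht
    have h := card_separating_colourings t.1 t.2 ht.1.1.2 ht.1.2.2 ht.2
    have h' := congrArg (Nat.cast : ℕ → ℝ) h
    push_cast at h'
    rw [Fintype.card_fun, Fintype.card_fin, Fintype.card_fin, hp, div_mul_eq_mul_div,
      div_le_iff₀ (by positivity)]
    push_cast
    rw [← h']) m
  have hUlt : (1 - p) ^ m * (S.card : ℝ) < 1 := by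
    have hLm : L < p * m := by
      have := Nat.lt_floor_add_one (L / p)
      rw [div_lt_iff₀ hp0] at this
      rw [hm]
      push_cast
      linarith
    calc (1 - p) ^ m * (S.card : ℝ) ≤ Real.exp (-p) ^ m * (n : ℝ) ^ (w + r) := by
          have h1 : 0 ≤ 1 - p := sub_nonneg.2 hp1
          have h2 := Real.one_sub_le_exp_neg p
          gcongr
      _ = Real.exp (L - p * m) := by
          have hnexp : (n : ℝ) ^ (w + r) = Real.exp L := by
            rw [hL, ← Nat.cast_add, Real.exp_nat_mul, Real.exp_log (by positivity)]
          rw [hnexp, ← Real.exp_nat_mul, ← Real.exp_add]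
          ring_nf
      _ < 1 := (Real.exp_lt_exp.2 (by linarith)).trans_eq Real.exp_zero
  have hempty : U = ∅ := by
    rw [← Finset.card_eq_zero]
    have := hFU.trans_lt hUlt
    exact Nat.lt_one_iff.1 (by exact_mod_cast this)
  refine ⟨F.image fun f i => decide ((f i : ℕ) < w), fun W R hW hR hWR => ?_, ?_⟩
  · have hmem : (W, R) ∈ S := by simp [S, Finset.mem_powersetCard, hW, hR, hWR]
    obtain ⟨f, hf, h1, h2⟩ := hcov (W, R) hmem (by simp [hempty])
    exact ⟨_, Finset.mem_image_of_mem _ hf, fun i hi => decide_eq_true (h1 i hi),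
      fun i hi => decide_eq_false (h2 i hi)⟩
  · have hL1 : 1 ≤ L / p := by
      rw [one_le_div hp0]
      have h2n : Real.log 2 ≤ Real.log n :=
        Real.log_le_log (by norm_num) (by exact_mod_cast hn)
      have := Real.log_two_gt_d9
      nlinarith
    have hmL : (m : ℝ) ≤ 2 * (L / p) := by
      have := Nat.floor_le (zero_le_one.trans hL1)
      rw [hm]
      push_cast
      linarith
    have hdp : ((w : ℝ) + r) / p ≤
        4 * (w + r).choose w * √((w : ℝ) * r * (w + r)) := by
      have hs := sqrt_mul_pow_le_choose (w := w) (r := r) (by omega) (by omega)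
      have hs' := mul_le_mul_of_nonneg_left hs (Real.sqrt_nonneg ((w : ℝ) + r))
      rw [← mul_assoc, Real.mul_self_sqrt (by positivity)] at hs'
      rw [hp, div_div_eq_mul_div, div_le_iff₀ (by positivity), Real.sqrt_mul (by positivity),
        Real.sqrt_mul (by positivity)]
      refine hs'.trans_eq ?_
      ring
    have hlog : Real.log n ≤ Real.logb 2 n := by
      rw [Real.logb, le_div_iff₀ (Real.log_pos (by norm_num))]
      nlinarith [Real.log_two_lt_d9]
    calc ((F.image fun f i => decide ((f i : ℕ) < w)).card : ℝ) ≤ m := by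
          exact_mod_cast Finset.card_image_le.trans hFm
      _ ≤ 2 * (L / p) := hmL
      _ = 2 * (((w : ℝ) + r) / p * Real.log n) := by rw [hL]; ring
      _ ≤ 2 * (4 * (w + r).choose w * √((w : ℝ) * r * (w + r)) * Real.logb 2 n) := by gcongr
      _ = _ := by ring
end
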